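/- Let μ be a Borel probability measure on ℝ^N × ℝ^N such that ∫ L dμ = 0 and ∫ Φ dμ ≥ 0 for every continuous Φ : ℝ^N × ℝ^N → ℝ that admits a subsolution and coincides with L outside some compact subset of ℝ^N × ℝ^N. Then μ has compact support. -/

import Mathlib

open MeasureTheory Set
open scoped RealInnerProductSpace

noncomputable section

abbrev Euc (N : ℕ) := EuclideanSpace ℝ (Fin N)

/-- `u` is an (a.e.) subsolution of `H = a` in `ℝ^N`. -/
def IsSubsol {N : ℕ} (H : Euc N × Euc N → ℝ) (a : ℝ) (u : Euc N → ℝ) : Prop :=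
  LocallyLipschitz u ∧
    ∀ᵐ x : Euc N ∂volume, DifferentiableAt ℝ u x → H (x, gradient u x) ≤ a

/-- `u` is an (a.e.) subsolution of the discounted equation `λ u + H(x,Du) = 0`. -/
def IsDiscSubsol {N : ℕ} (H : Euc N × Euc N → ℝ) (lam : ℝ) (u : Euc N → ℝ) : Prop :=
  LocallyLipschitz u ∧
    ∀ᵐ x : Euc N ∂volume, DifferentiableAt ℝ u x →
      lam * u x + H (x, gradient u x) ≤ 0

/-- The Lagrangian associated with `H` via the Fenchel transform. -/
def Lag {N : ℕ} (H : Euc N × Euc N → ℝ) : Euc N × Euc N → ℝ :=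
  fun z => sSup (Set.range fun p : Euc N => ⟪p, z.2⟫ - H (z.1, p))

/-- `u` is a subsolution for the generalized Lagrangian `Φ`. -/
def SubsolFor {N : ℕ} (Φ : Euc N × Euc N → ℝ) (u : Euc N → ℝ) : Prop :=
  LocallyLipschitz u ∧
    ∀ᵐ x : Euc N ∂volume, DifferentiableAt ℝ u x →
      ∀ q : Euc N, fderiv ℝ u x q ≤ Φ (x, q)

/-- `u` is a `λ`-discounted subsolution for the generalized Lagrangian `Φ`. -/
def DiscSubsolFor {N : ℕ} (lam : ℝ) (Φ : Euc N × Euc N → ℝ) (u : Euc N → ℝ) : Prop :=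
  LocallyLipschitz u ∧
    ∀ᵐ x : Euc N ∂volume, DifferentiableAt ℝ u x →
      ∀ q : Euc N, lam * u x + fderiv ℝ u x q ≤ Φ (x, q)

/-- A Mather measure for the ergodic problem. -/
def MatherMeasure {N : ℕ} (H : Euc N × Euc N → ℝ) (μ : Measure (Euc N × Euc N)) : Prop :=
  IsProbabilityMeasure μ ∧ Integrable (Lag H) μ ∧ (∫ z, Lag H z ∂μ) = 0 ∧
    ∀ Φ : Euc N × Euc N → ℝ, Continuous Φ → BddBelow (Set.range Φ) →
      (∃ u, SubsolFor Φ u) → (Integrable Φ μ → 0 ≤ ∫ z, Φ z ∂μ)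

/-- A `(λ,z)`-Mather measure (relative to the maximal discounted solution `um`). -/
def DiscMatherMeasure {N : ℕ} (H : Euc N × Euc N → ℝ) (lam : ℝ) (z : Euc N)
    (um : Euc N → ℝ) (μ : Measure (Euc N × Euc N)) : Prop :=
  IsProbabilityMeasure μ ∧ Integrable (Lag H) μ ∧ (∫ w, Lag H w ∂μ) = lam * um z ∧
    ∀ Φ : Euc N × Euc N → ℝ, Continuous Φ → BddBelow (Set.range Φ) →
      ∀ u : Euc N → ℝ, DiscSubsolFor lam Φ u →
        (Integrable Φ μ → lam * u z ≤ ∫ w, Φ w ∂μ)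

open Filter Topology

/-- **Rademacher's theorem** for locally Lipschitz functions. -/
theorem LocallyLipschitz.ae_differentiableAt_euc {N : ℕ} {u : Euc N → ℝ}
    (hu : LocallyLipschitz u) : ∀ᵐ x : Euc N ∂volume, DifferentiableAt ℝ u x := by
  rw [ae_iff]
  refine measure_null_of_locally_null _ fun x _ => ?_
  obtain ⟨K, t, ht, hK⟩ := hu x
  refine ⟨interior t ∩ {y | ¬DifferentiableAt ℝ u y}, inter_mem
    (mem_nhdsWithin_of_mem_nhds (interior_mem_nhds.2 ht)) self_mem_nhdsWithin, ?_⟩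
  refine measure_mono_null ?_
    (ae_iff.1 (hK.ae_differentiableWithinAt_of_mem (μ := (volume : Measure (Euc N)))))
  rintro y ⟨hyt, hy⟩ hd
  exact hy ((hd (interior_subset hyt)).differentiableAt (mem_interior_iff_mem_nhds.1 hyt))

theorem fderiv_eq_of_le_of_eq {N : ℕ} {f g : Euc N → ℝ} {x : Euc N} (hle : ∀ y, f y ≤ g y)
    (hx : f x = g x) (hf : DifferentiableAt ℝ f x) (hg : DifferentiableAt ℝ g x) :
    fderiv ℝ f x = fderiv ℝ g x := by
  have hmin : IsLocalMin (fun y => g y - f y) x :=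
    Eventually.of_forall fun y => by simp only [hx, sub_self, sub_nonneg, hle y]
  have h := hmin.fderiv_eq_zero
  rw [fderiv_fun_sub hg hf] at h
  exact (sub_eq_zero.1 h).symm

theorem abs_sub_le_of_ae_abs_deriv_le {f : ℝ → ℝ} {C : ℝ} (hf : LocallyLipschitz f)
    (hC : ∀ᵐ t : ℝ ∂volume, t ∈ Icc (0 : ℝ) 1 → |deriv f t| ≤ C) : |f 1 - f 0| ≤ C := by
  obtain ⟨K, hK⟩ := (hf.locallyLipschitzOn (s := uIcc 0 1)).exists_lipschitzOnWith_of_compact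
    isCompact_uIcc
  rw [← hK.absolutelyContinuousOnInterval.integral_deriv_eq_sub]
  have h := intervalIntegral.norm_integral_le_of_norm_le_const_ae (f := deriv f)
    (a := (0 : ℝ)) (b := 1) (C := C) (by
      filter_upwards [hC] with t ht hmem
      rw [uIoc_of_le zero_le_one] at hmem
      exact ht ⟨hmem.1.le, hmem.2⟩)
  simpa using h

theorem ae_ae_line {N : ℕ} {p : Euc N → Prop} (hp : ∀ᵐ x : Euc N ∂volume, p x) (v : Euc N) :
    ∀ᵐ x : Euc N ∂volume, ∀ᵐ t : ℝ ∂volume, p (x + t • v) := by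
  obtain ⟨s, hsub, hs, hs0⟩ := exists_measurable_superset_of_null (ae_iff.1 hp)
  have hmeas : MeasurableSet {z : Euc N × ℝ | z.1 + z.2 • v ∈ sᶜ} :=
    (Continuous.measurable (by fun_prop)) hs.compl
  have h : ∀ᵐ x : Euc N ∂volume, ∀ᵐ t : ℝ ∂volume, x + t • v ∈ sᶜ := by
    rw [Measure.ae_ae_comm hmeas]
    refine Eventually.of_forall fun t => ?_
    have h1 : ∀ᵐ x : Euc N ∂volume, x ∈ sᶜ := by
      rw [ae_iff]; simpa using hs0
    exact (measurePreserving_add_right volume (t • v)).quasiMeasurePreserving.ae h1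
  filter_upwards [h] with x hx
  filter_upwards [hx] with t ht
  by_contra hn
  exact ht (hsub hn)

/-- A locally Lipschitz function whose gradient is bounded by `M` almost everywhere on a larger
ball is `M`-Lipschitz on the smaller ball. -/
theorem abs_sub_le_of_ae_norm_fderiv_le {N : ℕ} {u : Euc N → ℝ} {R M : ℝ}
    (hu : LocallyLipschitz u)
    (hM : ∀ᵐ x : Euc N ∂volume, ‖x‖ ≤ R + 1 → ‖fderiv ℝ u x‖ ≤ M) {x y : Euc N}
    (hx : ‖x‖ ≤ R) (hy : ‖y‖ ≤ R) : |u y - u x| ≤ M * ‖y - x‖ := by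
  by_contra! hlt
  set v := y - x with hv
  have hopen : IsOpen {z : Euc N | M * ‖v‖ < |u (z + v) - u z| ∧ ‖z - x‖ < 1} := by
    have := hu.continuous
    have h1 : IsOpen {z : Euc N | M * ‖v‖ < |u (z + v) - u z|} :=
      isOpen_lt (by fun_prop) (by fun_prop)
    have h2 : IsOpen {z : Euc N | ‖z - x‖ < 1} := isOpen_lt (by fun_prop) (by fun_prop)
    exact h1.inter h2
  have hmem : x ∈ {z : Euc N | M * ‖v‖ < |u (z + v) - u z| ∧ ‖z - x‖ < 1} := by
    simp [hv] at hlt ⊢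
    exact hlt
  have hae := ae_ae_line (hM.and hu.ae_differentiableAt_euc) v
  obtain ⟨z, ⟨hz1, hz2⟩, hz⟩ := (Measure.dense_of_ae hae).inter_open_nonempty _ hopen ⟨x, hmem⟩
  refine hz1.not_ge ?_
  have hlip : LocallyLipschitz fun t : ℝ => u (z + t • v) := by
    have h2 : LipschitzWith ‖v‖₊ fun t : ℝ => z + t • v :=
      LipschitzWith.of_dist_le_mul fun s t => by
        simp [dist_eq_norm, ← sub_smul, norm_smul, mul_comm]
    exact hu.comp h2.locallyLipschitz
  have := abs_sub_le_of_ae_abs_deriv_le (C := M * ‖v‖) hlip (by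
    filter_upwards [hz] with t ht ht01
    have hd : HasDerivAt (fun t : ℝ => z + t • v) v t := by
      simpa using ((hasDerivAt_id t).smul_const v).const_add z
    have hd2 := (ht.2.hasFDerivAt.comp_hasDerivAt t hd).deriv
    have hnorm : ‖z + t • v‖ ≤ R + 1 := by
      have : z + t • v = (z - x) + ((1 - t) • x + t • y) := by
        rw [hv]; module
      rw [this]
      have h1 : ‖(1 - t) • x + t • y‖ ≤ R := by
        refine (norm_add_le _ _).trans ?_
        rw [norm_smul, norm_smul, Real.norm_of_nonneg ht01.1,
          Real.norm_of_nonneg (sub_nonneg.2 ht01.2)]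
        nlinarith [ht01.1, ht01.2]
      linarith [norm_add_le (z - x) ((1 - t) • x + t • y)]
    change |deriv (u ∘ fun t : ℝ => z + t • v) t| ≤ _
    rw [hd2]
    exact ((fderiv ℝ u (z + t • v)).le_opNorm v).trans
      (mul_le_mul_of_nonneg_right (ht.1 hnorm) (norm_nonneg _)))
  simpa using this

section Lagrangian

variable {N : ℕ} {H : Euc N × Euc N → ℝ}

/-- Near each point only momenta in a fixed ball matter in the definition of the Lagrangian. -/
theorem eventually_inner_sub_le (hA1 : Continuous H)
    (hconv : ∀ x : Euc N, ConvexOn ℝ Set.univ fun p => H (x, p))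
    (hsl : ∀ x : Euc N, ∀ C : ℝ, ∃ r : ℝ, ∀ p : Euc N, r ≤ ‖p‖ → C * ‖p‖ ≤ H (x, p))
    (z₀ : Euc N × Euc N) :
    ∃ ρ : ℝ, 0 ≤ ρ ∧ ∀ᶠ z in 𝓝 z₀, ∀ p : Euc N, ρ ≤ ‖p‖ →
      ⟪p, z.2⟫ - H (z.1, p) ≤ -H (z.1, 0) := by
  obtain ⟨x₀, q₀⟩ := z₀
  set C := ‖q₀‖ + 1
  obtain ⟨r, hr⟩ := hsl x₀ (C + 1)
  set ρ := max r (|H (x₀, 0)| + 1)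
  have hρpos : 0 < ρ := lt_of_lt_of_le (by positivity) (le_max_right _ _)
  refine ⟨ρ, hρpos.le, ?_⟩
  have hsphere : ∀ᶠ x in 𝓝 x₀, ∀ p ∈ Metric.sphere (0 : Euc N) ρ,
      C * ρ < H (x, p) - H (x, 0) := by
    refine (isCompact_sphere (0 : Euc N) ρ).eventually_forall_of_forall_eventually fun p hp => ?_
    have hp' : ‖p‖ = ρ := by simpa using hp
    have h1 := hr p (hp' ▸ le_max_left _ _)
    rw [hp'] at h1
    have h2 : |H (x₀, 0)| + 1 ≤ ρ := le_max_right _ _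
    have h3 := le_abs_self (H (x₀, 0))
    have hcont : Continuous fun w : Euc N × Euc N => H (w.1, w.2) - H (w.1, 0) := by fun_prop
    exact (hcont.tendsto (x₀, p)).eventually_const_lt (by simp only; nlinarith)
  have hq : ∀ᶠ q in 𝓝 q₀, ‖q‖ < C :=
    (continuous_norm.tendsto q₀).eventually_lt_const (by linarith)
  rw [nhds_prod_eq]
  filter_upwards [hsphere.prod_mk hq] with z hz p hp
  obtain ⟨hz1, hz2⟩ := hz
  have hppos : 0 < ‖p‖ := hρpos.trans_le hp
  set s := ρ / ‖p‖
  have hspos : 0 < s := by positivity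
  have hs1 : s ≤ 1 := (div_le_one hppos).2 hp
  have hsp : s * ‖p‖ = ρ := div_mul_cancel₀ _ hppos.ne'
  have h1 := hz1 (s • p) (by simp [norm_smul, abs_of_pos hspos, hsp])
  have h2 := (hconv z.1).2 (mem_univ p) (mem_univ 0) hspos.le (sub_nonneg.2 hs1) (by ring)
  simp only [smul_zero, add_zero, smul_eq_mul] at h2
  have h3 : s * (C * ‖p‖) < s * (H (z.1, p) - H (z.1, 0)) := by
    calc s * (C * ‖p‖) = C * ρ := by rw [← hsp]; ring
      _ < _ := h1
      _ ≤ _ := by linarith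
  have h4 := lt_of_mul_lt_mul_left h3 hspos.le
  have h5 := real_inner_le_norm p z.2
  nlinarith [norm_nonneg p]

theorem bddAbove_range_inner_sub (hA1 : Continuous H)
    (hconv : ∀ x : Euc N, ConvexOn ℝ Set.univ fun p => H (x, p))
    (hsl : ∀ x : Euc N, ∀ C : ℝ, ∃ r : ℝ, ∀ p : Euc N, r ≤ ‖p‖ → C * ‖p‖ ≤ H (x, p))
    (z : Euc N × Euc N) : BddAbove (Set.range fun p : Euc N => ⟪p, z.2⟫ - H (z.1, p)) := by
  obtain ⟨ρ, -, hev⟩ := eventually_inner_sub_le hA1 hconv hsl z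
  have hz := hev.self_of_nhds
  have hcont : Continuous fun p : Euc N => ⟪p, z.2⟫ - H (z.1, p) := by fun_prop
  obtain ⟨B, hB⟩ := (isCompact_closedBall (0 : Euc N) ρ).bddAbove_image hcont.continuousOn
  refine ⟨max B (-H (z.1, 0)), ?_⟩
  rintro _ ⟨p, rfl⟩
  rcases le_total ‖p‖ ρ with h | h
  · exact le_max_of_le_left (hB ⟨p, by simpa using h, rfl⟩)
  · exact le_max_of_le_right (hz p h)

/-- The Fenchel inequality. -/
theorem inner_le_lag_add (hA1 : Continuous H)
    (hconv : ∀ x : Euc N, ConvexOn ℝ Set.univ fun p => H (x, p))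
    (hsl : ∀ x : Euc N, ∀ C : ℝ, ∃ r : ℝ, ∀ p : Euc N, r ≤ ‖p‖ → C * ‖p‖ ≤ H (x, p))
    (x p q : Euc N) : ⟪p, q⟫ ≤ Lag H (x, q) + H (x, p) :=
  sub_le_iff_le_add.1 (le_csSup (bddAbove_range_inner_sub hA1 hconv hsl (x, q)) ⟨p, rfl⟩)

theorem continuous_lag (hA1 : Continuous H)
    (hconv : ∀ x : Euc N, ConvexOn ℝ Set.univ fun p => H (x, p))
    (hsl : ∀ x : Euc N, ∀ C : ℝ, ∃ r : ℝ, ∀ p : Euc N, r ≤ ‖p‖ → C * ‖p‖ ≤ H (x, p)) :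
    Continuous (Lag H) := by
  refine continuous_iff_continuousAt.2 fun z₀ => ?_
  obtain ⟨ρ, hρ, hev⟩ := eventually_inner_sub_le hA1 hconv hsl z₀
  have hK := isCompact_closedBall (0 : Euc N) ρ
  let F : Euc N × Euc N → Euc N → ℝ := fun z p => ⟪p, z.2⟫ - H (z.1, p)
  have hF : Continuous ↿F := by
    change Continuous fun y : (Euc N × Euc N) × Euc N => ⟪y.2, y.1.2⟫ - H (y.1.1, y.2)
    fun_prop
  refine (hK.continuous_sSup hF).continuousAt.congr ?_
  filter_upwards [hev] with z hz
  have hbdd : BddAbove (F z '' Metric.closedBall 0 ρ) :=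
    (bddAbove_range_inner_sub hA1 hconv hsl z).mono (image_subset_range _ _)
  refine le_antisymm (csSup_le_csSup (bddAbove_range_inner_sub hA1 hconv hsl z)
    ⟨_, 0, by simpa using hρ, rfl⟩ (image_subset_range _ _)) (csSup_le (range_nonempty _) ?_)
  rintro _ ⟨p, rfl⟩
  rcases le_total ‖p‖ ρ with h | h
  · exact le_csSup hbdd ⟨p, by simpa using h, rfl⟩
  · refine (hz p h).trans (le_csSup hbdd ⟨0, by simpa using hρ, ?_⟩)
    simp [F]

/-- The Lagrangian grows superlinearly in the velocity, uniformly for bounded positions. -/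
theorem exists_forall_mul_norm_add_one_le_lag (hA1 : Continuous H)
    (hconv : ∀ x : Euc N, ConvexOn ℝ Set.univ fun p => H (x, p))
    (hsl : ∀ x : Euc N, ∀ C : ℝ, ∃ r : ℝ, ∀ p : Euc N, r ≤ ‖p‖ → C * ‖p‖ ≤ H (x, p))
    (R M : ℝ) : ∃ r : ℝ, ∀ x q : Euc N, ‖x‖ ≤ R → r ≤ ‖q‖ → M * ‖q‖ + 1 ≤ Lag H (x, q) := by
  obtain ⟨B, hB⟩ := ((isCompact_closedBall (0 : Euc N) R).prod
    (isCompact_closedBall (0 : Euc N) |M + 1|)).bddAbove_image hA1.continuousOn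
  refine ⟨max 1 (B + 1), fun x q hx hq => ?_⟩
  have hq0 : 0 < ‖q‖ := lt_of_lt_of_le one_pos ((le_max_left _ _).trans hq)
  have hnorm : ‖((M + 1) / ‖q‖) • q‖ = |M + 1| := by
    rw [norm_smul, norm_div, norm_norm, Real.norm_eq_abs, div_mul_cancel₀ _ hq0.ne']
  have h1 := inner_le_lag_add hA1 hconv hsl x (((M + 1) / ‖q‖) • q) q
  have h2 : H (x, ((M + 1) / ‖q‖) • q) ≤ B :=
    hB ⟨_, ⟨by simpa using hx, by simp only [mem_closedBall_zero_iff, hnorm, le_refl]⟩, rfl⟩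
  have h3 : ⟪((M + 1) / ‖q‖) • q, q⟫ = (M + 1) * ‖q‖ := by
    rw [real_inner_smul_left, real_inner_self_eq_norm_sq]
    field_simp
  have h4 := (le_max_right 1 (B + 1)).trans hq
  linarith

end Lagrangian

section Subsolutions

variable {N : ℕ} {H : Euc N × Euc N → ℝ}

theorem gradient_eq_of_fderiv_eq {f g : Euc N → ℝ} {x : Euc N}
    (h : fderiv ℝ f x = fderiv ℝ g x) : gradient f x = gradient g x := by
  rw [gradient, gradient, h]

theorem norm_gradient_eq (f : Euc N → ℝ) (x : Euc N) : ‖gradient f x‖ = ‖fderiv ℝ f x‖ := by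
  rw [gradient, LinearIsometryEquiv.norm_map]

/-- If `H ≤ m` for small momenta outside the ball of radius `R`, a subsolution can be modified
outside that ball so as to become a subsolution of `H = m` far away. The radius beyond which this
happens depends on the subsolution only through a bound on the ball of radius `R`. -/
theorem IsSubsol.exists_modification {u : Euc N → ℝ} {a ε m R C : ℝ} (hu : IsSubsol H a u)
    (hε : 0 < ε) (hma : m ≤ a)
    (hR : ∀ x : Euc N, R ≤ ‖x‖ → ∀ p : Euc N, ‖p‖ ≤ ε → H (x, p) ≤ m)
    (hC : ∀ x, ‖x‖ ≤ R → |u x| ≤ C) :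
    ∃ w : Euc N → ℝ, LocallyLipschitz w ∧ ∀ᵐ x : Euc N ∂volume,
      H (x, gradient w x) ≤ a ∧ (R + (2 * C + 3) / ε ≤ ‖x‖ → H (x, gradient w x) ≤ m) := by
  let φ : Euc N → ℝ := fun x => C + 1 - ε * (‖x‖ - R)
  let v : Euc N → ℝ := fun x => max (u x) (-C - 1)
  let w : Euc N → ℝ := fun x => min (v x) (φ x)
  have hφlip : LipschitzWith ⟨ε, hε.le⟩ φ := LipschitzWith.of_dist_le_mul fun x y => by
    have h : φ x - φ y = ε * (‖y‖ - ‖x‖) := by simp only [φ]; ring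
    rw [Real.dist_eq, h, abs_mul, abs_of_pos hε, dist_comm x y, dist_eq_norm]
    exact mul_le_mul_of_nonneg_left (abs_norm_sub_norm_le y x) hε.le
  have hv : LocallyLipschitz v := hu.1.max_const _
  have hw : LocallyLipschitz w := hv.min hφlip.locallyLipschitz
  refine ⟨w, hw, ?_⟩
  filter_upwards [hu.2, hu.1.ae_differentiableAt_euc, hv.ae_differentiableAt_euc,
    hw.ae_differentiableAt_euc, hφlip.ae_differentiableAt] with x hux hdu hdv hdw hdφ
  have hin : w x = φ x → R ≤ ‖x‖ → H (x, gradient w x) ≤ m := fun h hx => by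
    refine hR x hx _ ?_
    rw [norm_gradient_eq, fderiv_eq_of_le_of_eq (fun y => min_le_right _ _) h hdw hdφ]
    exact norm_fderiv_le_of_lipschitz ℝ hφlip
  have hlow : ‖x‖ < R → w x = v x ∧ v x = u x ∧ w x ≠ φ x ∧ v x ≠ -C - 1 := fun hx => by
    have h1 := abs_le.1 (hC x hx.le)
    have h2 : v x = u x := max_eq_left (by linarith)
    have h3 : C + 1 < φ x := by
      have := mul_pos hε (sub_pos.2 hx)
      simp only [φ]; linarith
    have h4 : w x = v x := min_eq_left (by rw [h2]; linarith)
    refine ⟨h4, h2, ?_, ?_⟩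
    · rw [h4, h2]; exact (by linarith : u x < φ x).ne
    · rw [h2]; exact (by linarith : -C - 1 < u x).ne'
  constructor
  · rcases min_choice (v x) (φ x) with h | h
    · have hwv : gradient w x = gradient v x :=
        gradient_eq_of_fderiv_eq (fderiv_eq_of_le_of_eq (fun y => min_le_left _ _) h hdw hdv)
      rw [hwv]
      rcases max_choice (u x) (-C - 1) with h' | h'
      · rw [← gradient_eq_of_fderiv_eq
          (fderiv_eq_of_le_of_eq (fun y => le_max_left _ _) h'.symm hdu hdv)]
        exact hux hdu
      · have hx : R ≤ ‖x‖ := by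
          by_contra! hx
          exact (hlow hx).2.2.2 h'
        refine (hR x hx _ ?_).trans hma
        rw [norm_gradient_eq, ← fderiv_eq_of_le_of_eq (f := fun _ => -C - 1)
          (fun y => le_max_right _ _) h'.symm (differentiableAt_const _) hdv]
        simpa using hε.le
    · refine (hin h ?_).trans hma
      by_contra! hx
      exact (hlow hx).2.2.1 h
  · intro hx
    have h1 : 2 * C + 3 ≤ ε * (‖x‖ - R) := by
      rw [← div_le_iff₀' hε]; linarith
    have h2 : w x = φ x := min_eq_right (by
      have : -C - 1 ≤ v x := le_max_right _ _
      simp only [φ]; linarith)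
    by_cases hRx : R ≤ ‖x‖
    · exact hin h2 hRx
    · exact absurd h2 (hlow (not_le.1 hRx)).2.2.1

/-- The set of levels admitting a subsolution is nonempty. -/
theorem exists_isSubsol_zero (hA1 : Continuous H) {m R : ℝ}
    (hR : ∀ x : Euc N, R ≤ ‖x‖ → H (x, 0) ≤ m) : ∃ a : ℝ, IsSubsol H a fun _ => 0 := by
  have hcont : Continuous fun x : Euc N => H (x, 0) := by fun_prop
  obtain ⟨B, hB⟩ := (isCompact_closedBall (0 : Euc N) R).bddAbove_image hcont.continuousOn
  refine ⟨max B m, LocallyLipschitz.const 0, Eventually.of_forall fun x _ => ?_⟩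
  rw [show gradient (fun _ : Euc N => (0 : ℝ)) x = 0 by simp [gradient]]
  rcases le_total ‖x‖ R with h | h
  · exact le_max_of_le_left (hB ⟨x, by simpa using h, rfl⟩)
  · exact le_max_of_le_right (hR x h)

/-- If `H(x₀, ·) > m`, the levels admitting a subsolution stay away from `m`. -/
theorem exists_lt_forall_isSubsol (hA1 : Continuous H)
    (hcoer : ∀ R : ℝ, 0 < R → ∀ C : ℝ, ∃ r : ℝ, ∀ x p : Euc N,
      ‖x‖ ≤ R → r ≤ ‖p‖ → C ≤ H (x, p)) {m : ℝ} {x₀ : Euc N} (hx₀ : ∀ p : Euc N, m < H (x₀, p)) :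
    ∃ s : ℝ, m < s ∧ ∀ a u, IsSubsol H a u → s ≤ a := by
  obtain ⟨r, hr⟩ := hcoer (‖x₀‖ + 1) (by positivity) (m + 1)
  have hK := isCompact_closedBall (0 : Euc N) |r|
  obtain ⟨p₀, -, hp₀⟩ := hK.exists_isMinOn ⟨0, by simp⟩
    (f := fun p => H (x₀, p)) (by fun_prop)
  obtain ⟨s, hms, hs⟩ := exists_between (lt_min (hx₀ p₀) (lt_add_one m))
  refine ⟨s, hms, fun a u hu => ?_⟩
  have hev : ∀ᶠ x in 𝓝 x₀, ∀ p ∈ Metric.closedBall (0 : Euc N) |r|, s < H (x, p) := by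
    refine hK.eventually_forall_of_forall_eventually fun p hp => ?_
    exact (hA1.tendsto (x₀, p)).eventually_const_lt
      ((hs.trans_le (min_le_left _ _)).trans_le (hp₀ hp))
  have hball : ∀ᶠ x in 𝓝 x₀, ‖x‖ < ‖x₀‖ + 1 :=
    (continuous_norm.tendsto x₀).eventually_lt_const (lt_add_one _)
  obtain ⟨t, ht, hto, hx₀t⟩ := eventually_nhds_iff.1 (hev.and hball)
  have hae := hu.2.and hu.1.ae_differentiableAt_euc
  obtain ⟨x, hxt, hx, hd⟩ := (Measure.dense_of_ae hae).inter_open_nonempty t hto ⟨x₀, hx₀t⟩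
  refine le_trans ?_ (hx hd)
  rcases le_total ‖gradient u x‖ |r| with h | h
  · exact ((ht x hxt).1 _ (by simpa using h)).le
  · exact (hs.le.trans (min_le_right _ _)).trans
      (hr x _ (ht x hxt).2.le ((le_abs_self r).trans h))

end Subsolutions

theorem stmt13 {N : ℕ} (hN : 1 ≤ N) (H : Euc N × Euc N → ℝ)
    (hA1 : Continuous H)
    (hA2conv : ∀ x : Euc N, ConvexOn ℝ Set.univ fun p => H (x, p))
    (hA2coer : ∀ R : ℝ, 0 < R → ∀ C : ℝ, ∃ r : ℝ, ∀ x p : Euc N,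
      ‖x‖ ≤ R → r ≤ ‖p‖ → C ≤ H (x, p))
    (hA3 : ∃ ε > (0 : ℝ), ∃ m : ℝ,
      (∃ R : ℝ, ∀ x : Euc N, R ≤ ‖x‖ → ∀ p : Euc N, ‖p‖ ≤ ε → H (x, p) ≤ m) ∧
      (∃ x₀ : Euc N, ∀ p : Euc N, m < H (x₀, p)))
    (hcrit : sInf {a : ℝ | ∃ u : Euc N → ℝ, IsSubsol H a u} = 0)
    (hsl : ∀ x : Euc N, ∀ C : ℝ, ∃ r : ℝ, ∀ p : Euc N, r ≤ ‖p‖ → C * ‖p‖ ≤ H (x, p))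
    (μ : Measure (Euc N × Euc N)) (hprob : IsProbabilityMeasure μ)
    (hLint : Integrable (Lag H) μ) (hL0 : (∫ w, Lag H w ∂μ) = 0)
    (hPhi : ∀ Φ : Euc N × Euc N → ℝ, Continuous Φ → (∃ u : Euc N → ℝ, SubsolFor Φ u) →
      (∃ K : Set (Euc N × Euc N), IsCompact K ∧ ∀ w ∉ K, Φ w = Lag H w) →
      (Integrable Φ μ → 0 ≤ ∫ w, Φ w ∂μ)) :
    ∃ K : Set (Euc N × Euc N), IsCompact K ∧ μ Kᶜ = 0 := by
  obtain ⟨ε, hε, m, ⟨R₀, hR₀⟩, x₀, hx₀⟩ := hA3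
  set R := max R₀ 1
  have hRpos : 0 < R := lt_of_lt_of_le one_pos (le_max_right _ _)
  have hR : ∀ x : Euc N, R ≤ ‖x‖ → ∀ p : Euc N, ‖p‖ ≤ ε → H (x, p) ≤ m :=
    fun x hx => hR₀ x ((le_max_left _ _).trans hx)
  have hsub : ∀ a : ℝ, 0 < a → ∃ u, IsSubsol H a u := fun a ha => by
    obtain ⟨a₀, ha₀⟩ := exists_isSubsol_zero hA1 fun x hx => hR x hx 0 (by simpa using hε.le)
    obtain ⟨b, ⟨u, hu⟩, hb⟩ := exists_lt_of_csInf_lt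
      (s := {a : ℝ | ∃ u : Euc N → ℝ, IsSubsol H a u}) ⟨a₀, _, ha₀⟩ (hcrit.trans_lt ha)
    exact ⟨u, hu.1, hu.2.mono fun x hx hd => (hx hd).trans hb.le⟩
  have hm : m < 0 := by
    obtain ⟨s, hms, hs⟩ := exists_lt_forall_isSubsol hA1 hA2coer hx₀
    refine hms.trans_le (le_of_forall_gt fun a ha => ?_)
    obtain ⟨u, hu⟩ := hsub (a / 2) (half_pos ha)
    linarith [hs _ u hu]
  obtain ⟨M₀, hM₀⟩ := hA2coer (R + 1) (by positivity) 2
  set C := |M₀| * R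
  set R' := R + (2 * C + 3) / ε
  have hR'pos : 0 < R' := by positivity
  obtain ⟨M, hM⟩ := hA2coer R' hR'pos 2
  obtain ⟨r₀, hr₀⟩ := exists_forall_mul_norm_add_one_le_lag hA1 hA2conv hsl R' |M|
  have hmod : ∀ a : ℝ, 0 < a → a ≤ 1 → ∃ w : Euc N → ℝ, LocallyLipschitz w ∧
      ∀ᵐ x : Euc N ∂volume, H (x, gradient w x) ≤ a ∧
        (R' ≤ ‖x‖ → H (x, gradient w x) ≤ m) := by
    intro a ha ha1
    obtain ⟨u, hu⟩ := hsub a ha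
    have hlip : LocallyLipschitz fun x => u x - u 0 := hu.1.sub (LocallyLipschitz.const _)
    have hfd : ∀ x, fderiv ℝ (fun x => u x - u 0) x = fderiv ℝ u x :=
      fun x => fderiv_sub_const _
    have hu' : IsSubsol H a fun x => u x - u 0 := by
      refine ⟨hlip, ?_⟩
      filter_upwards [hu.2, hu.1.ae_differentiableAt_euc] with x hx hd _
      rw [gradient_eq_of_fderiv_eq (hfd x)]
      exact hx hd
    refine hu'.exists_modification hε (hm.trans ha).le hR fun x hx => ?_
    have h := abs_sub_le_of_ae_norm_fderiv_le (M := |M₀|) (R := R) hu.1 (by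
      filter_upwards [hu.2, hu.1.ae_differentiableAt_euc] with y hy hd hyR
      rw [← norm_gradient_eq]
      by_contra! hlt
      linarith [hy hd, hM₀ y _ hyR ((le_abs_self _).trans hlt.le)])
      (x := 0) (y := x) (by simpa using hRpos.le) hx
    rw [sub_zero] at h
    exact h.trans (mul_le_mul_of_nonneg_left hx (abs_nonneg _))
  set r := max R' r₀
  set δ := min 1 (-m)
  have hδpos : 0 < δ := lt_min one_pos (neg_pos.2 hm)
  let g : Euc N × Euc N → ℝ := fun z => max 0 (min 1 (r + 1 - ‖z‖))
  let f : ℕ → Euc N × Euc N → ℝ := fun j z => max 0 (min δ (min (‖z‖ - r) (j - ‖z‖)))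
  have hgc : Continuous g := by fun_prop
  have hfc : ∀ j, Continuous (f j) := fun j => by fun_prop
  have hg0 : ∀ z, 0 ≤ g z := fun z => le_max_left _ _
  have hg1 : ∀ z, g z ≤ 1 := fun z => max_le zero_le_one (min_le_left _ _)
  have hf0 : ∀ j z, 0 ≤ f j z := fun j z => le_max_left _ _
  have hfδ : ∀ j z, f j z ≤ δ := fun j z => max_le hδpos.le (min_le_left _ _)
  have hgi : Integrable g μ := Integrable.of_bound hgc.aestronglyMeasurable 1
    (Eventually.of_forall fun z => by rw [Real.norm_of_nonneg (hg0 z)]; exact hg1 z)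
  have hfi : ∀ j, Integrable (f j) μ := fun j => Integrable.of_bound
    (hfc j).aestronglyMeasurable δ
    (Eventually.of_forall fun z => by rw [Real.norm_of_nonneg (hf0 j z)]; exact hfδ j z)
  have hLc := continuous_lag hA1 hA2conv hsl
  have hineq : ∀ j, ∀ a : ℝ, 0 < a → a ≤ 1 → ∫ z, f j z ∂μ ≤ a := by
    intro j a ha ha1
    obtain ⟨w, hwlip, hw⟩ := hmod a ha ha1
    have key := hPhi (fun z => Lag H z + a * g z - f j z) (by fun_prop) ⟨w, hwlip, ?_⟩
      ⟨Metric.closedBall 0 (max (r + 1) j), isCompact_closedBall _ _, fun z hz => ?_⟩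
      ((hLint.add (hgi.const_mul a)).sub (hfi j))
    · rw [integral_sub (f := fun z => Lag H z + a * g z) (hLint.add (hgi.const_mul a)) (hfi j),
        integral_add hLint (hgi.const_mul a), hL0, integral_const_mul] at key
      have hgint : ∫ z, g z ∂μ ≤ 1 := by
        simpa using integral_mono hgi (integrable_const (1 : ℝ)) hg1
      nlinarith
    · filter_upwards [hw] with x hx _ q
      have hinner : fderiv ℝ w x q = ⟪gradient w x, q⟫ := by simp
      have hfen := inner_le_lag_add hA1 hA2conv hsl x (gradient w x) q
      have hag := mul_nonneg ha.le (hg0 (x, q))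
      have hfm := (hfδ j (x, q)).trans (min_le_right _ _)
      have hf1 := (hfδ j (x, q)).trans (min_le_left _ _)
      rw [hinner]
      rcases le_total R' ‖x‖ with hxR | hxR
      · linarith [hx.2 hxR]
      rcases le_total ‖q‖ r with hq | hq
      · have hz : ‖(x, q)‖ ≤ r := max_le (hxR.trans (le_max_left _ _)) hq
        have h1 : g (x, q) = 1 := by
          simp only [g]
          rw [min_eq_left (by linarith), max_eq_right zero_le_one]
        have h2 : f j (x, q) = 0 := max_eq_left
          ((min_le_right _ _).trans ((min_le_left _ _).trans (by linarith)))
        rw [h1, h2]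
        linarith [hx.1]
      · have h1 := hr₀ x q hxR ((le_max_right _ _).trans hq)
        have h2 : ‖gradient w x‖ ≤ |M| := by
          by_contra! hlt
          linarith [hx.1, hM x _ hxR ((le_abs_self _).trans hlt.le)]
        have h3 := real_inner_le_norm (gradient w x) q
        have h4 := mul_le_mul_of_nonneg_right h2 (norm_nonneg q)
        linarith
    · have hz' : max (r + 1) j < ‖z‖ := by simpa using hz
      have h1 : g z = 0 := max_eq_left ((min_le_right _ _).trans
        (by linarith [le_max_left (r + 1) (j : ℝ)]))
      have h2 : f j z = 0 := max_eq_left ((min_le_right _ _).trans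
        ((min_le_right _ _).trans (by linarith [le_max_right (r + 1) (j : ℝ)])))
      simp only [h1, h2]; ring
  have hfae : ∀ j, f j =ᵐ[μ] 0 := fun j => by
    rw [← integral_eq_zero_iff_of_nonneg (hf0 j) (hfi j)]
    refine le_antisymm (le_of_forall_pos_le_add fun a ha => ?_) (integral_nonneg (hf0 j))
    rw [zero_add]
    exact (hineq j _ (lt_min ha one_pos) (min_le_right _ _)).trans (min_le_left _ _)
  refine ⟨Metric.closedBall 0 r, isCompact_closedBall _ _, ?_⟩
  refine measure_mono_null ?_ (ae_iff.1 (ae_all_iff.2 hfae))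
  intro z hz hall
  obtain ⟨j, hj⟩ := exists_nat_gt ‖z‖
  have hz' : r < ‖z‖ := by simpa using hz
  have hpos : 0 < f j z := lt_max_of_lt_right
    (lt_min hδpos (lt_min (sub_pos.2 hz') (sub_pos.2 hj)))
  exact hpos.ne' (hall j)

end
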